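/- arXiv:2601.03998 — 2 statements merged into one kernel-verified Lean document; each statement's English description precedes it below -/
import Mathlib

section
/- For |q|<1, the identity 1 + 4·∑_{n≥0} (-1)^{n+1} q^{2n+1}/(1+q^{2n+1}) = (q;q)_∞²/(-q;q)_∞² holds. -/
open scoped BigOperators

/-- The infinite q-Pochhammer symbol `(a;q)_∞ = ∏_{j=0}^{∞} (1 - a q^j)`. -/
noncomputable def qPochInf (a q : ℂ) : ℂ := ∏' j : ℕ, (1 - a * q ^ j)


/-- finite product (q;q)_n -/
noncomputable def PP (q : ℂ) (n : ℕ) : ℂ := ∏ j ∈ Finset.range n, (1 - q * q ^ j)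
noncomputable def MM (q : ℂ) (n : ℕ) : ℂ := ∏ j ∈ Finset.range n, (1 - (-q) * q ^ j)

lemma one_sub_ne (q : ℂ) (hq : ‖q‖ < 1) (j : ℕ) : 1 - q * q ^ j ≠ 0 := by
  intro h
  have h1 : q ^ (j+1) = 1 := by rw [pow_succ']; linear_combination -h
  have h2 : ‖q‖ ^ (j+1) < 1 := pow_lt_one₀ (norm_nonneg _) hq (by omega)
  rw [← norm_pow, h1] at h2
  simp at h2

lemma one_add_ne (q : ℂ) (hq : ‖q‖ < 1) (j : ℕ) : 1 + q ^ (j+1) ≠ 0 := by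
  intro h
  have h1 : q ^ (j+1) = -1 := by linear_combination h
  have h2 : ‖q‖ ^ (j+1) < 1 := pow_lt_one₀ (norm_nonneg _) hq (by omega)
  rw [← norm_pow, h1] at h2
  simp at h2

lemma PP_succ (q : ℂ) (n : ℕ) : PP q (n+1) = PP q n * (1 - q ^ (n+1)) := by
  rw [PP, Finset.prod_range_succ, ← PP, pow_succ']

lemma MM_succ (q : ℂ) (n : ℕ) : MM q (n+1) = MM q n * (1 + q ^ (n+1)) := by
  rw [MM, Finset.prod_range_succ, ← MM, pow_succ']; ring

lemma PP_ne (q : ℂ) (hq : ‖q‖ < 1) (n : ℕ) : PP q n ≠ 0 :=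
  Finset.prod_ne_zero_iff.2 fun j _ => one_sub_ne q hq j

lemma MM_ne (q : ℂ) (hq : ‖q‖ < 1) (n : ℕ) : MM q n ≠ 0 :=
  Finset.prod_ne_zero_iff.2 fun j _ => by
    have := one_add_ne q hq j
    rw [pow_succ'] at this
    simpa using this

/-- numerator over (1+q^n) -/
noncomputable def uu (q : ℂ) (n : ℕ) : ℂ :=
  (-1) ^ (n+1) * q ^ ((n+1)*(n+2)/2) / (1 + q ^ (n+1))

noncomputable def TT (q : ℂ) (N n : ℕ) : ℂ :=
  uu q n / (PP q (N - (n+1)) * PP q (N + (n+1)))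

lemma tri (M : ℕ) : (M+1)*(M+2)/2 = M*(M+1)/2 + (M+1) := by
  have : (M+1)*(M+2) = M*(M+1) + (M+1)*2 := by ring
  rw [this, Nat.add_mul_div_right _ _ (by norm_num)]

lemma partial_id (q : ℂ) (hq : ‖q‖ < 1) (N M : ℕ) (h : M ≤ N) :
    (1 + q^(N+1))^2 * (1 / PP q (N+1)^2 + 4 * ∑ n ∈ Finset.range M, TT q (N+1) n)
      - (1 / PP q N^2 + 4 * ∑ n ∈ Finset.range M, TT q N n)
    = 4 * q^(N+1) / (1 - q^(N+1)) * ((-1)^M * q^(M*(M+1)/2) / (PP q (N-M) * PP q (N+1+M))) := by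
  induction M with
  | zero =>
    have h1 := PP_ne q hq N
    have h2 := one_sub_ne q hq N
    rw [← pow_succ'] at h2
    simp [PP_succ]
    field_simp
    ring
  | succ M ih =>
    obtain ⟨k, rfl⟩ : ∃ k, N = M + 1 + k := ⟨N - (M+1), by omega⟩
    have ih := ih (by omega)
    rw [Finset.sum_range_succ, Finset.sum_range_succ]
    have e : ∀ A B C D E F : ℂ, A * (B + 4 * C) - (D + 4 * E) = F →
      ∀ x y, A * (B + 4 * (C + x)) - (D + 4 * (E + y)) = F + 4 * (A * x - y) := by
      intro A B C D E F h x y; linear_combination h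
    rw [e _ _ _ _ _ _ ih]
    unfold TT uu
    rw [tri M]
    have s1 : M + 1 + k - M = k + 1 := by omega
    have s2 : M + 1 + k + 1 + M = 2*M+2+k := by omega
    have s3 : M + 1 + k + 1 - (M+1) = k + 1 := by omega
    have s4 : M + 1 + k + 1 + (M+1) = 2*M+2+k+1 := by omega
    have s5 : M + 1 + k - (M+1) = k := by omega
    have s6 : M + 1 + k + (M+1) = 2*M+2+k := by omega
    rw [s1, s2, s3, s4, s5, s6]
    rw [PP_succ, PP_succ]
    have a1 := PP_ne q hq k
    have a2 := PP_ne q hq (2*M+2+k)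
    have a3 := one_sub_ne q hq k
    have a4 := one_sub_ne q hq (2*M+2+k)
    have a5 := one_sub_ne q hq (M+1+k)
    have a6 := one_add_ne q hq M
    rw [← pow_succ'] at a3 a4 a5
    have r1 : q^(M+1+k+1) = q^(M+1) * q^(k+1) := by ring
    have r2 : q^(2*M+2+k+1) = (q^(M+1))^2 * q^(k+1) := by ring
    rw [pow_add q (M*(M+1)/2), pow_succ (-1 : ℂ) M]
    rw [r1] at a5 ⊢
    rw [r2] at a4 ⊢
    generalize q^(M+1) = x at *
    generalize q^(k+1) = y at *
    generalize q^(M*(M+1)/2) = z at *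
    generalize (-1:ℂ)^M = w at *
    generalize PP q k = u at *
    generalize PP q (2*M+2+k) = v at *
    field_simp
    ring

lemma finite_id (q : ℂ) (hq : ‖q‖ < 1) (N : ℕ) :
    1 / PP q N^2 + 4 * ∑ n ∈ Finset.range N, TT q N n = 1 / MM q N ^ 2 := by
  induction N with
  | zero => simp [PP, MM]
  | succ N ih =>
    have h := partial_id q hq N N le_rfl
    rw [ih] at h
    have a1 := PP_ne q hq (N+1+N)
    have a2 := MM_ne q hq N
    have a3 := one_sub_ne q hq N
    have a4 := one_add_ne q hq N
    have a5 := one_sub_ne q hq (N+1+N)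
    rw [← pow_succ'] at a3 a5
    have key : (1 + q^(N+1))^2 * (4 * TT q (N+1) N) = 
      - (4 * q^(N+1) / (1 - q^(N+1)) * ((-1)^N * q^(N*(N+1)/2) / (PP q (N-N) * PP q (N+1+N)))) := by
      unfold TT uu
      rw [tri N, ← add_assoc (N+1) N 1, PP_succ, Nat.sub_self, Nat.sub_self]
      have r : q^(N+1+N+1) = q^(N+1) * q^(N+1) := by ring
      rw [pow_add q (N*(N+1)/2), pow_succ (-1 : ℂ) N]
      have p0 : PP q 0 = 1 := by simp [PP]
      rw [p0]
      rw [r]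
      rw [r, show ∀ x : ℂ, 1 - x * x = (1 - x) * (1 + x) by intro x; ring] at a5
      rw [show ∀ x : ℂ, 1 - x * x = (1 - x) * (1 + x) by intro x; ring]
      generalize q^(N+1) = x at *
      generalize q^(N*(N+1)/2) = z at *
      generalize (-1:ℂ)^N = w at *
      generalize PP q (N+1+N) = v at *
      field_simp
    rw [Finset.sum_range_succ, MM_succ]
    have : (1 + q^(N+1))^2 * (1 / PP q (N+1)^2 + 4 * (∑ n ∈ Finset.range N, TT q (N+1) n + TT q (N+1) N)) = 1 / MM q N ^2 := by
      linear_combination h + key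
    generalize (1 / PP q (N+1)^2 + 4 * (∑ n ∈ Finset.range N, TT q (N+1) n + TT q (N+1) N)) = X at *
    field_simp at this ⊢
    linear_combination this

def ee : ℕ × ℕ ≃ ℕ × ℕ where
  toFun p := if p.1 ≤ p.2 then (2*p.1, p.2 - p.1) else (2*p.2+1, p.1 - p.2 - 1)
  invFun p := if p.1 % 2 = 0 then (p.1/2, p.2 + p.1/2) else (p.2 + p.1/2 + 1, p.1/2)
  left_inv := by
    rintro ⟨j, m⟩
    by_cases h : j ≤ m
    · simp [h]
    · simp only [h, if_false]
      have : (2*m+1)%2 ≠ 0 := by omega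
      simp only [this, if_false, Prod.mk.injEq]; omega
  right_inv := by
    rintro ⟨n, k⟩
    by_cases h : n % 2 = 0
    · simp [h]; omega
    · have : ¬ (k + n/2 + 1 ≤ n/2) := by omega
      simp only [h, if_false, this, Prod.mk.injEq]; omega

noncomputable def aa (q : ℂ) (p : ℕ × ℕ) : ℂ :=
  (-1)^(p.1+1) * q^((p.1+1)*(p.1+2)/2) * (-q^(p.1+1))^p.2
noncomputable def bb (q : ℂ) (p : ℕ × ℕ) : ℂ :=
  (-1)^(p.1+1) * q^(2*p.1+1) * (-q^(2*p.1+1))^p.2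

lemma aa_ee (q : ℂ) (p : ℕ × ℕ) : aa q (ee p) = bb q p := by
  obtain ⟨j, m⟩ := p
  by_cases h : j ≤ m
  · obtain ⟨k, rfl⟩ := Nat.exists_eq_add_of_le h
    simp only [aa, bb, ee, Equiv.coe_fn_mk, h, if_true]
    have : (2*j+1)*(2*j+2)/2 = (2*j+1)*(j+1) := by
      rw [show (2*j+1)*(2*j+2) = (2*j+1)*(j+1)*2 by ring]; simp
    rw [this, show j + k - j = k by omega, neg_pow (q^_), neg_pow (q^_)]
    simp only [pow_add, pow_mul, neg_one_sq, one_pow]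
    have : ((-1:ℂ)^j)*(-1)^j = 1 := by rw [← mul_pow]; simp
    ring_nf
    simp
  · obtain ⟨k, rfl⟩ : ∃ k, j = m + 1 + k := ⟨j - (m+1), by omega⟩
    simp only [aa, bb, ee, Equiv.coe_fn_mk, h, if_false]
    have : (2*m+1+1)*(2*m+1+2)/2 = (m+1)*(2*m+3) := by
      rw [show (2*m+1+1)*(2*m+1+2) = (m+1)*(2*m+3)*2 by ring]; simp
    rw [this, show m + 1 + k - m - 1 = k by omega, neg_pow (q^_), neg_pow (q^_)]
    ring_nf

lemma bb_summable (q : ℂ) (hq : ‖q‖ < 1) : Summable (bb q) := by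
  have hg := summable_geometric_of_lt_one (norm_nonneg q) hq
  have h2 := hg.mul_of_nonneg hg (fun n => by positivity) (fun n => by positivity)
  refine Summable.of_norm_bounded h2 ?_
  rintro ⟨j, m⟩
  simp only [bb, norm_mul, norm_pow, norm_neg, norm_one, one_pow, one_mul]
  rw [← pow_mul, ← pow_add, ← pow_add]
  exact pow_le_pow_of_le_one (norm_nonneg _) hq.le (by nlinarith)

lemma geo (q : ℂ) (hq : ‖q‖ < 1) (c : ℂ) (j : ℕ) :
    ∑' m : ℕ, c * (-q^(j+1))^m = c / (1 + q^(j+1)) := by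
  rw [tsum_mul_left, tsum_geometric_of_norm_lt_one]
  · rw [sub_neg_eq_add, div_eq_mul_inv]
  · rw [norm_neg, norm_pow]; exact pow_lt_one₀ (norm_nonneg _) hq (by omega)

lemma lambert (q : ℂ) (hq : ‖q‖ < 1) :
    ∑' n : ℕ, (-1 : ℂ) ^ (n + 1) * q ^ (2 * n + 1) / (1 + q ^ (2 * n + 1)) = ∑' n, uu q n := by
  have hb := bb_summable q hq
  have ha : Summable (aa q) := by
    rw [← ee.summable_iff]
    exact hb.congr fun p => (aa_ee q p).symm
  have h : ∑' p, aa q p = ∑' p, bb q p := by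
    rw [← ee.tsum_eq]; exact tsum_congr (aa_ee q)
  rw [ha.tsum_prod, hb.tsum_prod] at h
  simp only [aa, bb, geo q hq] at h
  exact h.symm

open Filter Topology

lemma summ_aux (a q : ℂ) (hq : ‖q‖ < 1) : Summable fun j : ℕ => ‖-(a * q^j)‖ := by
  simp only [norm_neg, norm_mul, norm_pow]
  exact (summable_geometric_of_lt_one (norm_nonneg q) hq).mul_left _

lemma poch_tendsto (a q : ℂ) (hq : ‖q‖ < 1) :
    Tendsto (fun n => ∏ j ∈ Finset.range n, (1 - a * q^j)) atTop (𝓝 (qPochInf a q)) := by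
  have := (multipliable_one_add_of_summable (summ_aux a q hq)).tendsto_prod_tprod_nat
  simpa only [← sub_eq_add_neg, qPochInf] using this

lemma poch_ne (a q : ℂ) (hq : ‖q‖ < 1) (h : ∀ j : ℕ, 1 - a * q^j ≠ 0) : qPochInf a q ≠ 0 := by
  have := tprod_one_add_ne_zero_of_summable (f := fun j : ℕ => -(a * q^j))
    (fun j => by simpa only [← sub_eq_add_neg] using h j) (summ_aux a q hq)
  simpa only [← sub_eq_add_neg, qPochInf] using this

lemma uu_bound (q : ℂ) (hq : ‖q‖ < 1) (n : ℕ) : ‖uu q n‖ ≤ ‖q‖^n / (1 - ‖q‖) := by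
  have h0 : 0 < 1 - ‖q‖ := by linarith
  have h1 : 1 - ‖q‖ ≤ ‖1 + q^(n+1)‖ := by
    have h2 : ‖q^(n+1)‖ ≤ ‖q‖ := by
      rw [norm_pow]; exact pow_le_of_le_one (norm_nonneg _) hq.le (by omega)
    have h3 := norm_sub_le (1 + q^(n+1)) (q^(n+1))
    simp only [add_sub_cancel_right, norm_one] at h3
    linarith
  rw [uu, norm_div, norm_mul, norm_pow, norm_neg, norm_one, one_pow, one_mul, norm_pow]
  gcongr ?_ / ?_
  refine pow_le_pow_of_le_one (norm_nonneg _) hq.le ?_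
  rw [tri]; omega

lemma main_lim (q : ℂ) (hq : ‖q‖ < 1) :
    1 + 4 * ∑' n, uu q n = qPochInf q q ^ 2 / qPochInf (-q) q ^ 2 := by
  have hP : Tendsto (PP q) atTop (𝓝 (qPochInf q q)) := poch_tendsto q q hq
  have hM : Tendsto (MM q) atTop (𝓝 (qPochInf (-q) q)) := poch_tendsto (-q) q hq
  have hP0 : qPochInf q q ≠ 0 := poch_ne q q hq (one_sub_ne q hq)
  have hM0 : qPochInf (-q) q ≠ 0 := poch_ne (-q) q hq fun j => by
    have := one_add_ne q hq j
    rw [pow_succ'] at this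
    simpa using this
  obtain ⟨C, hC⟩ := hP.norm.bddAbove_range
  obtain ⟨D, hD⟩ := (hP.inv₀ hP0).norm.bddAbove_range
  have hC' : ∀ n, ‖PP q n‖ ≤ C := fun n => hC ⟨n, rfl⟩
  have hD' : ∀ n, ‖(PP q n)⁻¹‖ ≤ D := fun n => hD ⟨n, rfl⟩
  have hC0 : 0 ≤ C := (norm_nonneg _).trans (hC' 0)
  have hD0 : 0 ≤ D := (norm_nonneg _).trans (hD' 0)
  have hlim : Tendsto (fun N => ∑' n, (if n < N then PP q N ^ 2 * TT q N n else 0)) atTop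
      (𝓝 (∑' n, uu q n)) := by
    refine tendsto_tsum_of_dominated_convergence
      (bound := fun n => C^2 * (‖q‖^n / (1 - ‖q‖) * (D * D))) ?_ ?_ ?_
    · exact (((summable_geometric_of_lt_one (norm_nonneg q) hq).div_const _).mul_right _).mul_left _
    · intro n
      have h1 : Tendsto (fun N => PP q (N - (n+1))) atTop (𝓝 (qPochInf q q)) :=
        hP.comp (tendsto_sub_atTop_nat (n+1))
      have h2 : Tendsto (fun N => PP q (N + (n+1))) atTop (𝓝 (qPochInf q q)) :=
        hP.comp (tendsto_add_atTop_nat (n+1))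
      have h3 := (hP.pow 2).mul ((tendsto_const_nhds (x := uu q n)).div (h1.mul h2)
        (mul_ne_zero hP0 hP0))
      have h4 : qPochInf q q ^ 2 * (uu q n / (qPochInf q q * qPochInf q q)) = uu q n := by
        field_simp
      rw [h4] at h3
      refine h3.congr' ?_
      filter_upwards [eventually_gt_atTop n] with N hN
      rw [if_pos hN]; rfl
    · refine Eventually.of_forall fun N n => ?_
      have h0 : 0 < 1 - ‖q‖ := by linarith
      split_ifs
      · rw [TT, norm_mul, norm_pow, div_eq_mul_inv, mul_inv, norm_mul, norm_mul]
        gcongr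
        · exact hC' N
        · exact uu_bound q hq n
        · exact hD' _
        · exact hD' _
      · rw [norm_zero]; positivity
  have hfin : ∀ N, PP q N ^ 2 / MM q N ^ 2 =
      1 + 4 * ∑' n, (if n < N then PP q N ^ 2 * TT q N n else 0) := by
    intro N
    have h1 := finite_id q hq N
    have h2 := PP_ne q hq N
    rw [tsum_eq_sum (s := Finset.range N) (fun n hn => if_neg (by simpa using hn))]
    rw [Finset.sum_congr rfl (fun n hn => if_pos (Finset.mem_range.1 hn)), ← Finset.mul_sum]
    rw [div_eq_mul_one_div, ← h1]
    field_simp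
  have hl := (hP.pow 2).div (hM.pow 2) (pow_ne_zero 2 hM0)
  refine tendsto_nhds_unique ((hlim.const_mul 4).const_add 1) (hl.congr hfin)

/-- For |q|<1, `1 + 4 ∑_{n≥0} (-1)^{n+1} q^{2n+1}/(1+q^{2n+1}) = (q;q)_∞²/(-q;q)_∞²`. -/
theorem stmt_6 (q : ℂ) (hq : ‖q‖ < 1) :
    1 + 4 * ∑' n : ℕ, (-1 : ℂ) ^ (n + 1) * q ^ (2 * n + 1) / (1 + q ^ (2 * n + 1))
      = qPochInf q q ^ 2 / qPochInf (-q) q ^ 2 := by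
  rw [lambert q hq]
  exact main_lim q hq
end

section
/- For |q|<1, Ramanujan's identity 2φ(−q) − f(q) = Θ(−q)²/(q;q)_∞ holds, where φ(q) = ∑_{n≥0} q^{n²}/(−q²;q²)_n, f(q) = ∑_{n≥0} q^{n²}/(−q;q)_n², and Θ(−q) = ∑_{n∈ℤ} (−1)^n q^{n²}. -/
open scoped BigOperators

/-- The finite q-Pochhammer symbol `(a;q)_n = ∏_{j=0}^{n-1} (1 - a q^j)`. -/
noncomputable def qPoch (a q : ℂ) (n : ℕ) : ℂ := ∏ j ∈ Finset.range n, (1 - a * q ^ j)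

/-- Ramanujan's third order mock theta function `φ(q) = ∑_{n≥0} q^{n²}/(-q²;q²)_n`. -/
noncomputable def mockPhi (q : ℂ) : ℂ := ∑' n : ℕ, q ^ (n ^ 2) / qPoch (-q ^ 2) (q ^ 2) n

/-- Ramanujan's third order mock theta function `f(q) = ∑_{n≥0} q^{n²}/(-q;q)_n²`. -/
noncomputable def mockF (q : ℂ) : ℂ := ∑' n : ℕ, q ^ (n ^ 2) / (qPoch (-q) q n) ^ 2

/-- The theta function `Θ(-q) = ∑_{n∈ℤ} (-1)^n q^{n²}`. -/
noncomputable def thetaNeg (q : ℂ) : ℂ := ∑' n : ℤ, (-1 : ℂ) ^ n * q ^ (n.natAbs ^ 2)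

/-! ### Basic facts -/

lemma qPoch_zero (a q : ℂ) : qPoch a q 0 = 1 := by simp [qPoch]

lemma qPoch_succ (a q : ℂ) (n : ℕ) : qPoch a q (n + 1) = qPoch a q n * (1 - a * q ^ n) := by
  simp [qPoch, Finset.prod_range_succ]

lemma norm_aux {a q : ℂ} (hq : ‖q‖ < 1) (ha : ‖a‖ < 1) (n : ℕ) : ‖a * q ^ n‖ < 1 := by
  rw [norm_mul, norm_pow]
  have h1 : ‖q‖ ^ n ≤ 1 := pow_le_one₀ (norm_nonneg _) hq.le
  nlinarith [norm_nonneg a, norm_nonneg q, pow_nonneg (norm_nonneg q) n]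

lemma one_sub_ne_s16 {x : ℂ} (hx : ‖x‖ < 1) : 1 - x ≠ 0 := by
  intro h
  have : x = 1 := by linear_combination -h
  rw [this] at hx
  simp at hx

lemma one_add_ne_s16 {x : ℂ} (hx : ‖x‖ < 1) : 1 + x ≠ 0 := by
  have := one_sub_ne_s16 (x := -x) (by simpa using hx)
  simpa using this

lemma one_add_pow_ne {q : ℂ} (hq : ‖q‖ < 1) (n : ℕ) : 1 + q ^ n ≠ 0 := by
  rcases Nat.eq_zero_or_pos n with rfl | h
  · norm_num
  · apply one_add_ne_s16
    rw [norm_pow]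
    exact pow_lt_one₀ (norm_nonneg _) hq h.ne'

lemma one_sub_pow_ne {q : ℂ} (hq : ‖q‖ < 1) (n : ℕ) : 1 - q ^ (n + 1) ≠ 0 := by
  apply one_sub_ne_s16
  rw [norm_pow]
  exact pow_lt_one₀ (norm_nonneg _) hq (by omega)

lemma qPoch_ne {a q : ℂ} (hq : ‖q‖ < 1) (ha : ‖a‖ < 1) (n : ℕ) : qPoch a q n ≠ 0 := by
  rw [qPoch, Finset.prod_ne_zero_iff]
  intro j _
  exact one_sub_ne_s16 (norm_aux hq ha j)

lemma summable_aux (a : ℂ) {q : ℂ} (hq : ‖q‖ < 1) : Summable fun j : ℕ => ‖-(a * q ^ j)‖ := by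
  simp only [norm_neg, norm_mul, norm_pow]
  exact (summable_geometric_of_lt_one (norm_nonneg _) hq).mul_left _

lemma multipliable_aux (a : ℂ) {q : ℂ} (hq : ‖q‖ < 1) :
    Multipliable fun j : ℕ => (1 - a * q ^ j) := by
  simpa [sub_eq_add_neg] using multipliable_one_add_of_summable (summable_aux a hq)

lemma qPochInf_ne {a q : ℂ} (hq : ‖q‖ < 1) (ha : ‖a‖ < 1) : qPochInf a q ≠ 0 := by
  have := tprod_one_add_ne_zero_of_summable (f := fun j : ℕ => -(a * q ^ j)) (fun j => by
    simpa [sub_eq_add_neg] using one_sub_ne_s16 (norm_aux hq ha j)) (summable_aux a hq)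
  simpa [qPochInf, sub_eq_add_neg] using this

lemma qPoch_tendsto (a : ℂ) {q : ℂ} (hq : ‖q‖ < 1) :
    Filter.Tendsto (qPoch a q) Filter.atTop (nhds (qPochInf a q)) :=
  (multipliable_aux a hq).hasProd.tendsto_prod_nat

lemma bdd_of_tendsto {u : ℕ → ℂ} {l : ℂ} (h : Filter.Tendsto u Filter.atTop (nhds l)) :
    ∃ C : ℝ, 0 < C ∧ ∀ n, ‖u n‖ ≤ C := by
  obtain ⟨C, hC⟩ := h.norm.bddAbove_range
  refine ⟨max C 1, by positivity, fun n => le_max_of_le_left (hC ⟨n, rfl⟩)⟩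

lemma qPoch_inv_bdd {a q : ℂ} (hq : ‖q‖ < 1) (ha : ‖a‖ < 1) :
    ∃ C : ℝ, 0 < C ∧ ∀ n, ‖(qPoch a q n)⁻¹‖ ≤ C :=
  bdd_of_tendsto ((qPoch_tendsto a hq).inv₀ (qPochInf_ne hq ha))

lemma qPochInf_split (a : ℂ) {q : ℂ} (hq : ‖q‖ < 1) (n : ℕ) :
    qPochInf a q = qPoch a q n * qPochInf (a * q ^ n) q := by
  have h1 := (qPoch_tendsto (a * q ^ n) hq).const_mul (qPoch a q n)
  have h2 := (qPoch_tendsto a hq).comp (Filter.tendsto_add_atTop_nat n)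
  refine tendsto_nhds_unique h2 (h1.congr fun k => ?_)
  simp only [Function.comp, qPoch]
  rw [add_comm k n, Finset.prod_range_add]
  congr 1
  refine Finset.prod_congr rfl fun j _ => ?_
  ring

/-! ### Power series with bounded coefficients -/

lemma summable_pow_series {u : ℕ → ℂ} {C : ℝ} (hu : ∀ k, ‖u k‖ ≤ C) {z : ℂ} (hz : ‖z‖ < 1) :
    Summable fun k => u k * z ^ k := by
  refine Summable.of_norm_bounded
    ((summable_geometric_of_lt_one (norm_nonneg z) hz).mul_left C) fun k => ?_
  rw [norm_mul, norm_pow]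
  exact mul_le_mul_of_nonneg_right (hu k) (by positivity)

lemma series_tendsto {u : ℕ → ℂ} {C : ℝ} (hu : ∀ k, ‖u k‖ ≤ C) {q z : ℂ} (hq : ‖q‖ < 1)
    (hz : ‖z‖ < 1) :
    Filter.Tendsto (fun n : ℕ => ∑' k, u k * (z * q ^ n) ^ k) Filter.atTop (nhds (u 0)) := by
  have h0 : u 0 = ∑' k : ℕ, if k = 0 then u 0 else 0 := by simp
  rw [h0]
  refine tendsto_tsum_of_dominated_convergence
    ((summable_geometric_of_lt_one (norm_nonneg z) hz).mul_left C) ?_ ?_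
  · intro k
    rcases Nat.eq_zero_or_pos k with rfl | hk
    · simp
    · simp only [hk.ne', if_false]
      have h1 : Filter.Tendsto (fun n : ℕ => u k * (z * q ^ n) ^ k) Filter.atTop
          (nhds (u k * (z * 0) ^ k)) :=
        ((((tendsto_pow_atTop_nhds_zero_of_norm_lt_one hq).const_mul z).pow k).const_mul _)
      simpa [hk.ne'] using h1
  · refine Filter.Eventually.of_forall fun n k => ?_
    rw [norm_mul, norm_pow]
    have hC : 0 ≤ C := (norm_nonneg _).trans (hu 0)
    have h1 : ‖z * q ^ n‖ ≤ ‖z‖ := by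
      rw [norm_mul, norm_pow]
      exact mul_le_of_le_one_right (norm_nonneg _) (pow_le_one₀ (norm_nonneg _) hq.le)
    exact mul_le_mul (hu k) (pow_le_pow_left₀ (norm_nonneg _) h1 k) (by positivity) hC

/-- `tri k = k (k - 1) / 2`. -/
def tri_s16 : ℕ → ℕ
  | 0 => 0
  | k + 1 => tri_s16 k + k

lemma tri_add (n k : ℕ) : tri_s16 (n + k) = tri_s16 n + tri_s16 k + n * k := by
  induction k with
  | zero => simp [tri_s16]
  | succ k ih => rw [← add_assoc, tri_s16, ih, tri_s16]; ring

lemma sq_tri (n : ℕ) : n ^ 2 = 2 * tri_s16 n + n := by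
  induction n with
  | zero => simp [tri_s16]
  | succ n ih => rw [tri_s16]; linarith [ih, show (n + 1) ^ 2 = n ^ 2 + 2 * n + 1 by ring]

lemma qq_ne {q : ℂ} (hq : ‖q‖ < 1) (n : ℕ) : qPoch q q n ≠ 0 := qPoch_ne hq hq n

lemma qq_succ (q : ℂ) (n : ℕ) : qPoch q q (n + 1) = qPoch q q n * (1 - q ^ (n + 1)) := by
  rw [qPoch_succ]; ring

lemma euler_one_bdd {q : ℂ} (hq : ‖q‖ < 1) :
    ∃ C : ℝ, 0 < C ∧ ∀ k, ‖q ^ tri_s16 k / qPoch q q k‖ ≤ C := by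
  obtain ⟨C, hC, h⟩ := qPoch_inv_bdd hq hq
  refine ⟨C, hC, fun k => ?_⟩
  rw [div_eq_mul_inv, norm_mul, norm_pow]
  calc _ ≤ 1 * ‖(qPoch q q k)⁻¹‖ :=
        mul_le_mul_of_nonneg_right (pow_le_one₀ (norm_nonneg _) hq.le) (norm_nonneg _)
    _ ≤ C := by rw [one_mul]; exact h k

/-- Euler: `(-z;q)_∞ = ∑ q^{k(k-1)/2} z^k / (q;q)_k`. -/
lemma euler_one {q z : ℂ} (hq : ‖q‖ < 1) (hz : ‖z‖ < 1) :
    qPochInf (-z) q = ∑' k, q ^ tri_s16 k / qPoch q q k * z ^ k := by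
  obtain ⟨C, hC, hu⟩ := euler_one_bdd hq
  set u : ℕ → ℂ := fun k => q ^ tri_s16 k / qPoch q q k with hudef
  have hu' : ∀ k, ‖u k‖ ≤ C := hu
  have hstep : ∀ w : ℂ, ‖w‖ < 1 → ∑' k, u k * w ^ k = (1 + w) * ∑' k, u k * (w * q) ^ k := by
    intro w hw
    have hwq : ‖w * q‖ < 1 := by simpa using norm_aux hq hw 1
    have s1 := summable_pow_series hu' hw
    have s2 := summable_pow_series hu' hwq
    have h1 : ∑' k, u k * w ^ k - ∑' k, u k * (w * q) ^ k = w * ∑' k, u k * (w * q) ^ k := by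
      rw [← s1.tsum_sub s2, (s1.sub s2).tsum_eq_zero_add, ← tsum_mul_left]
      simp only [pow_zero, mul_one, sub_self, zero_add]
      refine tsum_congr fun k => ?_
      simp only [hudef, tri_s16, qq_succ]
      have := qq_ne hq k
      have := one_sub_pow_ne hq k
      field_simp
      ring
    linear_combination h1
  have hfin : ∀ n : ℕ, ∑' k, u k * z ^ k = qPoch (-z) q n * ∑' k, u k * (z * q ^ n) ^ k := by
    intro n
    induction n with
    | zero => simp [qPoch_zero]
    | succ n ih =>
      rw [ih, hstep _ (norm_aux hq hz n), qPoch_succ]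
      simp only [pow_succ, mul_assoc]
      ring
  have hl := (qPoch_tendsto (-z) hq).mul (series_tendsto hu' hq hz)
  have hu0 : u 0 = 1 := by simp [hudef, tri_s16, qPoch_zero]
  rw [hu0, mul_one] at hl
  exact tendsto_nhds_unique hl ((tendsto_const_nhds).congr hfin)

/-- Euler: `(z;q)_∞ ∑ z^k / (q;q)_k = 1`. -/
lemma euler_two {q z : ℂ} (hq : ‖q‖ < 1) (hz : ‖z‖ < 1) :
    qPochInf z q * ∑' k, (qPoch q q k)⁻¹ * z ^ k = 1 := by
  obtain ⟨C, hC, hu'⟩ := qPoch_inv_bdd hq hq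
  set u : ℕ → ℂ := fun k => (qPoch q q k)⁻¹ with hudef
  replace hu' : ∀ k, ‖u k‖ ≤ C := hu'
  have hstep : ∀ w : ℂ, ‖w‖ < 1 → (1 - w) * ∑' k, u k * w ^ k = ∑' k, u k * (w * q) ^ k := by
    intro w hw
    have hwq : ‖w * q‖ < 1 := by simpa using norm_aux hq hw 1
    have s1 := summable_pow_series hu' hw
    have s2 := summable_pow_series hu' hwq
    have h1 : ∑' k, u k * w ^ k - ∑' k, u k * (w * q) ^ k = w * ∑' k, u k * w ^ k := by
      rw [← s1.tsum_sub s2, (s1.sub s2).tsum_eq_zero_add, ← tsum_mul_left]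
      simp only [pow_zero, mul_one, sub_self, zero_add]
      refine tsum_congr fun k => ?_
      simp only [hudef, qq_succ]
      have := qq_ne hq k
      have := one_sub_pow_ne hq k
      field_simp
      ring
    linear_combination h1
  have hfin : ∀ n : ℕ, qPoch z q n * ∑' k, u k * z ^ k = ∑' k, u k * (z * q ^ n) ^ k := by
    intro n
    induction n with
    | zero => simp [qPoch_zero]
    | succ n ih =>
      have := hstep _ (norm_aux hq hz n)
      rw [← ih] at this
      rw [qPoch_succ, pow_succ, ← mul_assoc z, ← this]
      ring
  have hl := (qPoch_tendsto z hq).mul_const (∑' k, u k * z ^ k)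
  have hu0 : u 0 = 1 := by simp [hudef, qPoch_zero]
  have hr := series_tendsto hu' hq hz
  rw [hu0] at hr
  exact tendsto_nhds_unique hl (hr.congr fun n => (hfin n).symm)

/-! ### Finite identities -/

lemma fin_f {q : ℂ} (hq : ‖q‖ < 1) (m : ℕ) :
    ∑ p ∈ Finset.HasAntidiagonal.antidiagonal m, q ^ tri_s16 p.1 / qPoch (-q) q p.1 * (qPoch q q p.2)⁻¹
      = 2 / (1 + q ^ m) * (qPoch q q m)⁻¹ := by
  have hq' : ‖-q‖ < 1 := by simpa using hq
  rcases m with _ | m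
  · simp [tri_s16, qPoch_zero]; norm_num
  have h1 : ∑ p ∈ Finset.HasAntidiagonal.antidiagonal (m + 1),
      (1 + q ^ p.1) * (q ^ tri_s16 p.1 / qPoch (-q) q p.1 * (qPoch q q p.2)⁻¹)
      = 2 * (qPoch q q (m + 1))⁻¹ + ∑ p ∈ Finset.HasAntidiagonal.antidiagonal m,
        q ^ p.1 * (q ^ tri_s16 p.1 / qPoch (-q) q p.1 * (qPoch q q p.2)⁻¹) := by
    rw [Finset.Nat.sum_antidiagonal_succ]
    congr 1
    · simp [tri_s16, qPoch_zero]; norm_num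
    · refine Finset.sum_congr rfl fun p _ => ?_
      have a1 := qPoch_ne hq hq' p.1
      have a2 := one_add_pow_ne hq (p.1 + 1)
      have a3 := qq_ne hq p.2
      have e : qPoch (-q) q (p.1 + 1) = qPoch (-q) q p.1 * (1 + q ^ (p.1 + 1)) := by
        rw [qPoch_succ]; ring
      simp only [tri_s16, e]
      field_simp
      ring
  have h2 : ∑ p ∈ Finset.HasAntidiagonal.antidiagonal (m + 1),
      q ^ p.1 * (1 - q ^ p.2) * (q ^ tri_s16 p.1 / qPoch (-q) q p.1 * (qPoch q q p.2)⁻¹)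
      = ∑ p ∈ Finset.HasAntidiagonal.antidiagonal m,
        q ^ p.1 * (q ^ tri_s16 p.1 / qPoch (-q) q p.1 * (qPoch q q p.2)⁻¹) := by
    rw [Finset.Nat.sum_antidiagonal_succ']
    simp only [pow_zero, sub_self, mul_zero, zero_mul, zero_add]
    refine Finset.sum_congr rfl fun p _ => ?_
    have a1 := qPoch_ne hq hq' p.1
    have a2 := one_sub_pow_ne hq p.2
    have a3 := qq_ne hq p.2
    rw [qq_succ]
    field_simp
  have h3 : (1 + q ^ (m + 1)) * ∑ p ∈ Finset.HasAntidiagonal.antidiagonal (m + 1),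
      q ^ tri_s16 p.1 / qPoch (-q) q p.1 * (qPoch q q p.2)⁻¹ = 2 * (qPoch q q (m + 1))⁻¹ := by
    have : (1 + q ^ (m + 1)) * ∑ p ∈ Finset.HasAntidiagonal.antidiagonal (m + 1),
      q ^ tri_s16 p.1 / qPoch (-q) q p.1 * (qPoch q q p.2)⁻¹ =
      ∑ p ∈ Finset.HasAntidiagonal.antidiagonal (m + 1),
      (1 + q ^ p.1) * (q ^ tri_s16 p.1 / qPoch (-q) q p.1 * (qPoch q q p.2)⁻¹) -
      ∑ p ∈ Finset.HasAntidiagonal.antidiagonal (m + 1),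
      q ^ p.1 * (1 - q ^ p.2) * (q ^ tri_s16 p.1 / qPoch (-q) q p.1 * (qPoch q q p.2)⁻¹) := by
      rw [Finset.mul_sum, ← Finset.sum_sub_distrib]
      refine Finset.sum_congr rfl fun p hp => ?_
      rw [← Finset.HasAntidiagonal.mem_antidiagonal.mp hp, pow_add]
      ring
    rw [this, h1, h2]
    ring
  have a2 := one_add_pow_ne hq (m + 1)
  rw [div_mul_eq_mul_div, eq_div_iff a2, ← h3]
  ring

/-- `a_i = (-1)^i q^{i(i+1)/2}/(q;q)_i`. -/
noncomputable def aSeq (q : ℂ) (i : ℕ) : ℂ := (-1) ^ i * q ^ (tri_s16 i + i) / qPoch q q i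

/-- `b_k = q^{2k}/(q²;q²)_k`. -/
noncomputable def bSeq (q : ℂ) (k : ℕ) : ℂ := q ^ (2 * k) / qPoch (q ^ 2) (q ^ 2) k

/-- `e_i = (-1)^i (2/(1+q^i)) q^{i(i-1)/2}/(q;q)_i`. -/
noncomputable def eSeq (q : ℂ) (i : ℕ) : ℂ :=
  (-1) ^ i * (2 / (1 + q ^ i)) * q ^ tri_s16 i / qPoch q q i

lemma norm_sq_lt {q : ℂ} (hq : ‖q‖ < 1) : ‖q ^ 2‖ < 1 := by
  rw [norm_pow]; exact pow_lt_one₀ (norm_nonneg _) hq (by norm_num)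

lemma aSeq_succ {q : ℂ} (hq : ‖q‖ < 1) (i : ℕ) :
    (1 - q ^ (i + 1)) * aSeq q (i + 1) = - q ^ (i + 1) * aSeq q i := by
  have := qq_ne hq i
  have := one_sub_pow_ne hq i
  simp only [aSeq, qq_succ, tri_s16]
  field_simp
  ring

lemma QQ_succ {q : ℂ} (hq : ‖q‖ < 1) (k : ℕ) :
    (1 - q ^ (2 * (k + 1))) * (qPoch (q ^ 2) (q ^ 2) (k + 1))⁻¹ = (qPoch (q ^ 2) (q ^ 2) k)⁻¹ := by
  have := qq_ne (norm_sq_lt hq) k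
  have := one_sub_pow_ne (norm_sq_lt hq) k
  rw [qq_succ, pow_mul]
  field_simp

lemma bSeq_succ {q : ℂ} (hq : ‖q‖ < 1) (k : ℕ) :
    (1 - q ^ (2 * (k + 1))) * bSeq q (k + 1) = q ^ 2 * bSeq q k := by
  have := QQ_succ hq k
  simp only [bSeq, div_eq_mul_inv]
  linear_combination q ^ (2 * (k + 1)) * this

lemma eSeq_succ {q : ℂ} (hq : ‖q‖ < 1) (i : ℕ) :
    (1 - q ^ (2 * (i + 1))) * eSeq q (i + 1) = - 2 * aSeq q i := by
  have := qq_ne hq i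
  have := one_sub_pow_ne hq i
  have := one_add_pow_ne hq (i + 1)
  have e : (1 - q ^ (2 * (i + 1))) = (1 - q ^ (i + 1)) * (1 + q ^ (i + 1)) := by ring
  rw [e]
  simp only [eSeq, aSeq, qq_succ, tri_s16]
  field_simp
  ring

/-- shifting the first index -/
lemma conv_shift_left (u v : ℕ → ℂ) (hu : u 0 = 0) (m : ℕ) :
    ∑ p ∈ Finset.HasAntidiagonal.antidiagonal (m + 1), u p.1 * v p.2
      = ∑ p ∈ Finset.HasAntidiagonal.antidiagonal m, u (p.1 + 1) * v p.2 := by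
  rw [Finset.Nat.sum_antidiagonal_succ]; simp [hu]

lemma conv_shift_right (u v : ℕ → ℂ) (hv : v 0 = 0) (m : ℕ) :
    ∑ p ∈ Finset.HasAntidiagonal.antidiagonal (m + 1), u p.1 * v p.2
      = ∑ p ∈ Finset.HasAntidiagonal.antidiagonal m, u p.1 * v (p.2 + 1) := by
  rw [Finset.Nat.sum_antidiagonal_succ']; simp [hv]

noncomputable def xSum (q : ℂ) (m : ℕ) : ℂ :=
  ∑ p ∈ Finset.HasAntidiagonal.antidiagonal m, aSeq q p.1 * bSeq q p.2

noncomputable def ySum (q : ℂ) (m : ℕ) : ℂ :=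
  ∑ p ∈ Finset.HasAntidiagonal.antidiagonal m, eSeq q p.1 * (qPoch (q ^ 2) (q ^ 2) p.2)⁻¹

lemma x_aux {q : ℂ} (hq : ‖q‖ < 1) (m : ℕ) :
    ∑ p ∈ Finset.HasAntidiagonal.antidiagonal m, q ^ p.1 * aSeq q p.1 * bSeq q p.2 = q ^ (2 * m) * xSum q m := by
  rcases m with _ | m
  · simp [xSum]
  have h1 := conv_shift_left (fun i => q ^ i * ((1 - q ^ i) * aSeq q i)) (bSeq q) (by simp) m
  have h2 := conv_shift_right (fun i => q ^ (2 * i) * aSeq q i)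
    (fun k => (1 - q ^ (2 * k)) * bSeq q k) (by simp) m
  simp only [aSeq_succ hq, bSeq_succ hq] at h1 h2
  have h3 : ∑ p ∈ Finset.HasAntidiagonal.antidiagonal (m + 1), q ^ p.1 * aSeq q p.1 * bSeq q p.2
      - q ^ (2 * (m + 1)) * xSum q (m + 1) =
      ∑ p ∈ Finset.HasAntidiagonal.antidiagonal (m + 1), q ^ p.1 * ((1 - q ^ p.1) * aSeq q p.1) * bSeq q p.2 +
      ∑ p ∈ Finset.HasAntidiagonal.antidiagonal (m + 1), q ^ (2 * p.1) * aSeq q p.1 *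
        ((1 - q ^ (2 * p.2)) * bSeq q p.2) := by
    rw [xSum, Finset.mul_sum, ← Finset.sum_sub_distrib, ← Finset.sum_add_distrib]
    refine Finset.sum_congr rfl fun p hp => ?_
    rw [← Finset.HasAntidiagonal.mem_antidiagonal.mp hp]
    ring
  rw [h1, h2, ← Finset.sum_add_distrib] at h3
  rw [← sub_eq_zero, h3]
  refine Finset.sum_eq_zero fun p _ => ?_
  ring

lemma x_rec {q : ℂ} (hq : ‖q‖ < 1) (m : ℕ) :
    (1 - q ^ (2 * (m + 1))) * xSum q (m + 1) = - q ^ (2 * m + 1) * xSum q m := by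
  have h1 := conv_shift_left (fun i => (1 + q ^ i) * ((1 - q ^ i) * aSeq q i)) (bSeq q) (by simp) m
  have h2 := conv_shift_right (fun i => q ^ (2 * i) * aSeq q i)
    (fun k => (1 - q ^ (2 * k)) * bSeq q k) (by simp) m
  simp only [aSeq_succ hq, bSeq_succ hq] at h1 h2
  have h3 : (1 - q ^ (2 * (m + 1))) * xSum q (m + 1) =
      ∑ p ∈ Finset.HasAntidiagonal.antidiagonal (m + 1), (1 + q ^ p.1) * ((1 - q ^ p.1) * aSeq q p.1) * bSeq q p.2 +
      ∑ p ∈ Finset.HasAntidiagonal.antidiagonal (m + 1), q ^ (2 * p.1) * aSeq q p.1 *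
        ((1 - q ^ (2 * p.2)) * bSeq q p.2) := by
    rw [xSum, Finset.mul_sum, ← Finset.sum_add_distrib]
    refine Finset.sum_congr rfl fun p hp => ?_
    rw [← Finset.HasAntidiagonal.mem_antidiagonal.mp hp]
    ring
  rw [h3, h1, h2, ← Finset.sum_add_distrib]
  have h4 := x_aux hq m
  have h5 : - q ^ (2 * m + 1) * xSum q m =
      -q * ∑ p ∈ Finset.HasAntidiagonal.antidiagonal m, q ^ p.1 * aSeq q p.1 * bSeq q p.2 := by
    rw [h4]; ring
  rw [h5, Finset.mul_sum]
  refine Finset.sum_congr rfl fun p _ => ?_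
  ring

lemma x_eq {q : ℂ} (hq : ‖q‖ < 1) (m : ℕ) :
    qPoch (q ^ 2) (q ^ 2) m * xSum q m = (-1) ^ m * q ^ (m ^ 2) := by
  induction m with
  | zero => simp [xSum, aSeq, bSeq, tri_s16, qPoch_zero]
  | succ m ih =>
    have h := x_rec hq m
    rw [qq_succ, ← pow_mul, mul_assoc, h, show (m + 1) ^ 2 = m ^ 2 + (2 * m + 1) by ring, pow_add q]
    linear_combination (- q ^ (2 * m + 1)) * ih

lemma y_zero (q : ℂ) : ySum q 0 = 1 := by
  simp [ySum, eSeq, tri_s16, qPoch_zero]; norm_num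

lemma y_rec {q : ℂ} (hq : ‖q‖ < 1) (m : ℕ) :
    (1 - q ^ (2 * (m + 1))) * ySum q (m + 1) = ySum q m - 2 * xSum q m := by
  have h1 := conv_shift_left (fun i => (1 - q ^ (2 * i)) * eSeq q i) (bSeq q) (by simp) m
  have h2 := conv_shift_right (eSeq q)
    (fun k => (1 - q ^ (2 * k)) * (qPoch (q ^ 2) (q ^ 2) k)⁻¹) (by simp) m
  simp only [eSeq_succ hq, QQ_succ hq] at h1 h2
  have h3 : (1 - q ^ (2 * (m + 1))) * ySum q (m + 1) =
      ∑ p ∈ Finset.HasAntidiagonal.antidiagonal (m + 1), eSeq q p.1 *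
        ((1 - q ^ (2 * p.2)) * (qPoch (q ^ 2) (q ^ 2) p.2)⁻¹) +
      ∑ p ∈ Finset.HasAntidiagonal.antidiagonal (m + 1), (1 - q ^ (2 * p.1)) * eSeq q p.1 * bSeq q p.2 := by
    rw [ySum, Finset.mul_sum, ← Finset.sum_add_distrib]
    refine Finset.sum_congr rfl fun p hp => ?_
    rw [← Finset.HasAntidiagonal.mem_antidiagonal.mp hp, bSeq]
    ring
  rw [h3, h1, h2, ySum, xSum, Finset.mul_sum, ← Finset.sum_sub_distrib, ← Finset.sum_add_distrib]
  refine Finset.sum_congr rfl fun p _ => ?_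
  ring

lemma y_diff {q : ℂ} (hq : ‖q‖ < 1) (m : ℕ) :
    qPoch (q ^ 2) (q ^ 2) (m + 1) * ySum q (m + 1) =
      qPoch (q ^ 2) (q ^ 2) m * ySum q m - 2 * ((-1) ^ m * q ^ (m ^ 2)) := by
  rw [← x_eq hq, qq_succ, ← pow_mul, mul_assoc, y_rec hq]
  ring

/-! Shanks' finite form of Gauss' identity -/

/-- `P_n = (q;q)_n/(-q;q)_n` -/
noncomputable def pSeq (q : ℂ) (n : ℕ) : ℂ := qPoch q q n / qPoch (-q) q n

lemma pSeq_ne {q : ℂ} (hq : ‖q‖ < 1) (n : ℕ) : pSeq q n ≠ 0 :=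
  div_ne_zero (qq_ne hq n) (qPoch_ne hq (by simpa using hq) n)

lemma pSeq_succ {q : ℂ} (hq : ‖q‖ < 1) (n : ℕ) :
    (1 + q ^ (n + 1)) * pSeq q (n + 1) = (1 - q ^ (n + 1)) * pSeq q n := by
  have a1 := qPoch_ne hq (a := -q) (by simpa using hq) n
  have a2 := one_add_pow_ne hq (n + 1)
  have e : qPoch (-q) q (n + 1) = qPoch (-q) q n * (1 + q ^ (n + 1)) := by
    rw [qPoch_succ]; ring
  rw [pSeq, pSeq, qq_succ, e]
  field_simp

noncomputable def shTerm (q : ℂ) (n s : ℕ) : ℂ :=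
  (-1) ^ s * (2 / (1 + q ^ s)) * q ^ (s * (n + 1)) * (pSeq q n / pSeq q s)

noncomputable def shSum (q : ℂ) (n : ℕ) : ℂ := ∑ s ∈ Finset.range (n + 1), shTerm q n s

lemma sh_partial {q : ℂ} (hq : ‖q‖ < 1) (n N : ℕ) :
    ∑ s ∈ Finset.range (N + 1), (shTerm q (n + 1) s - shTerm q n s) =
      - (2 * pSeq q n / (1 + q ^ (n + 1)) * ((-1) ^ N * q ^ ((N + 1) * (n + 1)) / pSeq q N)) := by
  have b1 := one_add_pow_ne hq (n + 1)
  have b2 := pSeq_succ hq n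
  have b3 : pSeq q (n + 1) = (1 - q ^ (n + 1)) * pSeq q n / (1 + q ^ (n + 1)) := by
    rw [eq_div_iff b1, ← b2]; ring
  induction N with
  | zero =>
    simp only [shTerm, b3]
    have := pSeq_ne hq 0
    simp
    field_simp
    ring
  | succ N ih =>
    rw [Finset.sum_range_succ, ih]
    have c1 := one_add_pow_ne hq (N + 1)
    have c2 := one_sub_pow_ne hq N
    have c3 : pSeq q (N + 1) = (1 - q ^ (N + 1)) * pSeq q N / (1 + q ^ (N + 1)) := by
      rw [eq_div_iff c1, ← pSeq_succ hq N]; ring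
    have c4 := pSeq_ne hq N
    simp only [shTerm, b3, c3]
    field_simp
    ring

lemma sh_diff {q : ℂ} (hq : ‖q‖ < 1) (n : ℕ) :
    shSum q (n + 1) = shSum q n + 2 * ((-1) ^ (n + 1) * q ^ ((n + 1) ^ 2)) := by
  have h := sh_partial hq n n
  rw [Finset.sum_sub_distrib] at h
  have a0 := pSeq_ne hq n
  have a1 := pSeq_ne hq (n + 1)
  have b1 := one_add_pow_ne hq (n + 1)
  rw [shSum, Finset.sum_range_succ, shSum]
  have h2 : - (2 * pSeq q n / (1 + q ^ (n + 1)) * ((-1) ^ n * q ^ ((n + 1) * (n + 1)) / pSeq q n))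
      + shTerm q (n + 1) (n + 1) = 2 * ((-1) ^ (n + 1) * q ^ ((n + 1) ^ 2)) := by
    simp only [shTerm]
    field_simp
    ring
  linear_combination h + h2

/-! ### Analytic part -/

lemma summable_double {g : ℕ × ℕ → ℂ} {C r : ℝ} (h0 : 0 ≤ r) (h1 : r < 1)
    (hg : ∀ p, ‖g p‖ ≤ C * (r ^ p.1 * r ^ p.2)) : Summable g := by
  have hs := summable_geometric_of_lt_one h0 h1
  have := hs.mul_of_nonneg hs (fun n => pow_nonneg h0 n) (fun n => pow_nonneg h0 n)
  exact Summable.of_norm_bounded (this.mul_left C) hg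

lemma tsum_antidiag {g : ℕ × ℕ → ℂ} (hg : Summable g) :
    ∑' p, g p = ∑' m, ∑ p ∈ Finset.HasAntidiagonal.antidiagonal m, g p := by
  conv_rhs => congr; ext; rw [← Finset.sum_finset_coe, ← tsum_fintype (L := .unconditional _)]
  rw [← Finset.HasAntidiagonal.sigmaAntidiagonalEquivProd.tsum_eq g]
  exact (Finset.HasAntidiagonal.sigmaAntidiagonalEquivProd.summable_iff.mpr hg).tsum_sigma'
    (fun n ↦ (hasSum_fintype _).summable)

lemma mockF_eq {q : ℂ} (hq : ‖q‖ < 1) :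
    qPochInf (-q) q * mockF q = ∑' m, eSeq q m * (-q) ^ m := by
  have hq' : ‖-q‖ < 1 := by simpa using hq
  obtain ⟨C, hC, hu⟩ := qPoch_inv_bdd hq hq
  obtain ⟨D, hD, hv⟩ := qPoch_inv_bdd hq hq'
  set g : ℕ × ℕ → ℂ := fun p => q ^ (p.1 ^ 2) / qPoch (-q) q p.1 *
    (q ^ tri_s16 p.2 / qPoch q q p.2 * (q ^ (p.1 + 1)) ^ p.2) with hgdef
  have hgs : Summable g := by
    refine summable_double (C := D * C) (norm_nonneg q) hq fun p => ?_
    have e : g p = (qPoch (-q) q p.1)⁻¹ * (qPoch q q p.2)⁻¹ *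
        q ^ (p.1 ^ 2 + tri_s16 p.2 + (p.1 + 1) * p.2) := by
      simp only [hgdef]
      rw [pow_add, pow_add, pow_mul]
      ring
    rw [e, norm_mul, norm_mul, norm_pow, ← pow_add]
    refine mul_le_mul (mul_le_mul (hv _) (hu _) (norm_nonneg _) hD.le) ?_ (by positivity)
      (by positivity)
    refine pow_le_pow_of_le_one (norm_nonneg _) hq.le ?_
    rw [sq_tri]
    nlinarith
  have h1 : qPochInf (-q) q * mockF q = ∑' n, ∑' k, g (n, k) := by
    rw [mockF, ← tsum_mul_left]
    refine tsum_congr fun n => ?_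
    have hz : ‖q ^ (n + 1)‖ < 1 := by
      rw [norm_pow]; exact pow_lt_one₀ (norm_nonneg _) hq (by omega)
    simp only [hgdef]
    rw [tsum_mul_left, ← euler_one hq hz, qPochInf_split (-q) hq n]
    have := qPoch_ne hq hq' n
    rw [show -q * q ^ n = -q ^ (n + 1) by ring]
    field_simp
  rw [h1, ← hgs.tsum_prod, tsum_antidiag hgs]
  refine tsum_congr fun m => ?_
  have h2 := fin_f hq m
  have h3 : eSeq q m * (-q) ^ m = q ^ (tri_s16 m + m) * (2 / (1 + q ^ m) * (qPoch q q m)⁻¹) := by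
    rw [eSeq, neg_pow q, pow_add]
    have : ((-1 : ℂ) ^ m) * (-1) ^ m = 1 := by rw [← mul_pow]; norm_num
    linear_combination (2 / (1 + q ^ m) * q ^ tri_s16 m * q ^ m * (qPoch q q m)⁻¹) * this
  rw [h3, ← h2, Finset.mul_sum]
  refine Finset.sum_congr rfl fun p hp => ?_
  rw [← Finset.HasAntidiagonal.mem_antidiagonal.mp hp]
  simp only [hgdef]
  rw [sq_tri, tri_add, ← pow_mul]
  ring

noncomputable def hSeq (q : ℂ) (n : ℕ) : ℂ := (-1) ^ n * q ^ (n ^ 2)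

lemma norm_hSeq_le {q : ℂ} (hq : ‖q‖ < 1) (n : ℕ) : ‖hSeq q n‖ ≤ ‖q‖ ^ n := by
  rw [hSeq, norm_mul, norm_pow, norm_pow, norm_neg, norm_one, one_pow, one_mul]
  exact pow_le_pow_of_le_one (norm_nonneg _) hq.le (by nlinarith [sq_tri n])

lemma summable_hSeq {q : ℂ} (hq : ‖q‖ < 1) : Summable (hSeq q) :=
  Summable.of_norm_bounded (summable_geometric_of_lt_one (norm_nonneg q) hq) (norm_hSeq_le hq)

noncomputable def tailS (q : ℂ) (m : ℕ) : ℂ := ∑' n, hSeq q (n + m)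

lemma tailS_succ {q : ℂ} (hq : ‖q‖ < 1) (m : ℕ) :
    tailS q m = (-1) ^ m * q ^ (m ^ 2) + tailS q (m + 1) := by
  have hs : Summable fun n => hSeq q (n + m) := (summable_nat_add_iff m).mpr (summable_hSeq hq)
  rw [tailS, hs.tsum_eq_zero_add, tailS, zero_add, hSeq]
  congr 1
  refine tsum_congr fun n => ?_
  rw [add_assoc, add_comm 1 m]

lemma tailS_tendsto (q : ℂ) :
    Filter.Tendsto (tailS q) Filter.atTop (nhds 0) :=
  tendsto_sum_nat_add (hSeq q)

lemma theta_eq {q : ℂ} (hq : ‖q‖ < 1) : thetaNeg q = 2 * tailS q 0 - 1 := by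
  have hs1 : Summable fun n => hSeq q (n + 1) := (summable_nat_add_iff 1).mpr (summable_hSeq hq)
  have e1 : ∀ n : ℕ, (-1 : ℂ) ^ (n : ℤ) * q ^ ((n : ℤ).natAbs ^ 2) = hSeq q n := by
    intro n; simp [hSeq]
  have e2 : ∀ n : ℕ, (-1 : ℂ) ^ (-((n : ℤ) + 1)) * q ^ ((-((n : ℤ) + 1)).natAbs ^ 2)
      = hSeq q (n + 1) := by
    intro n
    have h1 : (-((n : ℤ) + 1)).natAbs = n + 1 := by omega
    have h2 : (-1 : ℂ) ^ (-((n : ℤ) + 1)) = (-1) ^ (n + 1) := by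
      rw [zpow_neg, ← inv_zpow, inv_neg, inv_one]
      exact_mod_cast zpow_natCast (-1 : ℂ) (n + 1)
    rw [h1, h2, hSeq]
  rw [thetaNeg, tsum_of_nat_of_neg_add_one]
  · simp only [e1, e2]
    have h0 := tailS_succ hq 0
    simp only [tailS, add_zero, zero_add] at h0 ⊢
    simp at h0
    rw [h0]
    ring
  · simpa only [e1] using summable_hSeq hq
  · simpa only [e2] using hs1

lemma y_eq {q : ℂ} (hq : ‖q‖ < 1) (m : ℕ) :
    qPoch (q ^ 2) (q ^ 2) m * ySum q m = 2 * tailS q m - thetaNeg q := by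
  induction m with
  | zero => rw [theta_eq hq, y_zero, qPoch_zero]; ring
  | succ m ih => rw [y_diff hq, ih, tailS_succ hq m]; ring

lemma sh_eq {q : ℂ} (hq : ‖q‖ < 1) (n : ℕ) : shSum q n = thetaNeg q - 2 * tailS q (n + 1) := by
  induction n with
  | zero =>
    have h := tailS_succ hq 0
    simp at h
    rw [theta_eq hq, h]
    simp [shSum, shTerm, pSeq, qPoch_zero]
    norm_num
    ring
  | succ n ih => rw [sh_diff hq, ih, tailS_succ hq (n + 1)]; ring

lemma sh_tendsto {q : ℂ} (hq : ‖q‖ < 1) :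
    Filter.Tendsto (shSum q) Filter.atTop (nhds (qPochInf q q / qPochInf (-q) q)) := by
  have hq' : ‖-q‖ < 1 := by simpa using hq
  have hP : Filter.Tendsto (pSeq q) Filter.atTop (nhds (qPochInf q q / qPochInf (-q) q)) :=
    (qPoch_tendsto q hq).div (qPoch_tendsto (-q) hq) (qPochInf_ne hq hq')
  have hPn : qPochInf q q / qPochInf (-q) q ≠ 0 :=
    div_ne_zero (qPochInf_ne hq hq) (qPochInf_ne hq hq')
  obtain ⟨A, hA, hA'⟩ := bdd_of_tendsto hP
  obtain ⟨B, hB, hB'⟩ := bdd_of_tendsto (hP.inv₀ hPn)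
  have hD : Filter.Tendsto (fun s : ℕ => 2 / (1 + q ^ s)) Filter.atTop (nhds (2 / (1 + 0))) :=
    tendsto_const_nhds.div
      (tendsto_const_nhds.add (tendsto_pow_atTop_nhds_zero_of_norm_lt_one hq)) (by norm_num)
  obtain ⟨D, hDp, hD'⟩ := bdd_of_tendsto hD
  have hs := summable_geometric_of_lt_one (norm_nonneg q) hq
  set K : ℝ := D * A * B * ∑' s : ℕ, ‖q‖ ^ s with hK
  have hbound : ∀ n, ‖shSum q n - pSeq q n‖ ≤ K * ‖q‖ ^ n := by
    intro n
    have e : shSum q n - pSeq q n = ∑ s ∈ Finset.range n, shTerm q n (s + 1) := by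
      rw [shSum, Finset.sum_range_succ']
      have : shTerm q n 0 = pSeq q n := by
        simp [shTerm, pSeq, qPoch_zero]; norm_num
      rw [this]; ring
    rw [e]
    calc _ ≤ ∑ s ∈ Finset.range n, D * A * B * ‖q‖ ^ n * ‖q‖ ^ s := by
          refine norm_sum_le_of_le _ fun s _ => ?_
          rw [shTerm, norm_mul, norm_mul, norm_mul, norm_pow, norm_neg, norm_one, one_pow, one_mul,
            div_eq_mul_inv (pSeq q n), norm_mul, norm_pow]
          have h1 : ‖q‖ ^ ((s + 1) * (n + 1)) ≤ ‖q‖ ^ (n + s) :=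
            pow_le_pow_of_le_one (norm_nonneg _) hq.le (by nlinarith)
          calc _ ≤ D * ‖q‖ ^ (n + s) * (A * B) :=
                mul_le_mul (mul_le_mul (hD' _) h1 (by positivity) hDp.le)
                  (mul_le_mul (hA' _) (hB' _) (norm_nonneg _) hA.le) (by positivity) (by positivity)
            _ = _ := by rw [pow_add]; ring
      _ = D * A * B * ‖q‖ ^ n * ∑ s ∈ Finset.range n, ‖q‖ ^ s := by rw [Finset.mul_sum]
      _ ≤ D * A * B * ‖q‖ ^ n * ∑' s : ℕ, ‖q‖ ^ s := by
          refine mul_le_mul_of_nonneg_left ?_ (by positivity)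
          exact hs.sum_le_tsum _ fun i _ => by positivity
      _ = _ := by rw [hK]; ring
  have hz : Filter.Tendsto (fun n => shSum q n - pSeq q n) Filter.atTop (nhds 0) := by
    refine squeeze_zero_norm hbound ?_
    simpa using (tendsto_pow_atTop_nhds_zero_of_lt_one (norm_nonneg q) hq).const_mul K
  simpa using hz.add hP

/-- Gauss: `Θ(-q) = (q;q)_∞/(-q;q)_∞`. -/
lemma theta_prod {q : ℂ} (hq : ‖q‖ < 1) : thetaNeg q = qPochInf q q / qPochInf (-q) q := by
  refine tendsto_nhds_unique ?_ (sh_tendsto hq)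
  have h := ((tailS_tendsto q).comp (Filter.tendsto_add_atTop_nat 1)).const_mul 2
  have h2 := h.const_sub (thetaNeg q)
  rw [mul_zero, sub_zero] at h2
  exact h2.congr fun n => (sh_eq hq n).symm

lemma mockPhi_eq {q : ℂ} (hq : ‖q‖ < 1) :
    qPochInf (-q ^ 2) (q ^ 2) * mockPhi (-q) =
      ∑' m, (qPoch (q ^ 2) (q ^ 2) m)⁻¹ * (-q) ^ m * tailS q m := by
  have hQ := norm_sq_lt hq
  have hQ' : ‖-q ^ 2‖ < 1 := by simpa using hQ
  obtain ⟨C, hC, hu⟩ := qPoch_inv_bdd hQ hQ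
  set g : ℕ → ℕ → ℂ := fun n m => (qPoch (q ^ 2) (q ^ 2) m)⁻¹ * (-q) ^ m * hSeq q (n + m) with hg
  have hgs : Summable (Function.uncurry g) := by
    refine summable_double (C := C) (norm_nonneg q) hq fun p => ?_
    simp only [Function.uncurry, hg]
    rw [norm_mul, norm_mul, norm_pow, norm_neg, mul_assoc]
    refine mul_le_mul (hu _) ?_ (by positivity) hC.le
    have h1 := norm_hSeq_le hq (p.1 + p.2)
    have h2 : ‖q‖ ^ p.2 ≤ 1 := pow_le_one₀ (norm_nonneg _) hq.le
    calc _ ≤ 1 * ‖q‖ ^ (p.1 + p.2) := mul_le_mul h2 h1 (norm_nonneg _) (by norm_num)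
      _ = _ := by rw [one_mul, pow_add]
  have h1 : qPochInf (-q ^ 2) (q ^ 2) * mockPhi (-q) = ∑' n, ∑' m, g n m := by
    rw [mockPhi, ← tsum_mul_left]
    refine tsum_congr fun n => ?_
    have hz : ‖(q ^ 2) ^ (n + 1)‖ < 1 := by
      rw [norm_pow]; exact pow_lt_one₀ (norm_nonneg _) hQ (by omega)
    have e : ∀ m, g n m = hSeq q n *
        ((q ^ 2) ^ tri_s16 m / qPoch (q ^ 2) (q ^ 2) m * ((q ^ 2) ^ (n + 1)) ^ m) := by
      intro m
      simp only [hg, hSeq]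
      have h1 : (-q) ^ m = (-1) ^ m * q ^ m := neg_pow q m
      have h2 : ((-1 : ℂ) ^ m) * (-1) ^ m = 1 := by rw [← mul_pow]; norm_num
      have h3 : q ^ m * q ^ ((n + m) ^ 2) =
          q ^ (n ^ 2) * (q ^ 2) ^ tri_s16 m * ((q ^ 2) ^ (n + 1)) ^ m := by
        simp only [← pow_mul, ← pow_add]
        congr 1
        have := sq_tri m
        nlinarith
      rw [h1, pow_add (-1 : ℂ), div_eq_mul_inv]
      linear_combination (qPoch (q ^ 2) (q ^ 2) m)⁻¹ * (-1) ^ n * (q ^ m * q ^ ((n + m) ^ 2)) * h2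
        + (qPoch (q ^ 2) (q ^ 2) m)⁻¹ * (-1) ^ n * h3
    simp only [e]
    rw [tsum_mul_left, ← euler_one hQ hz, qPochInf_split (-q ^ 2) hQ n, neg_sq]
    have := qPoch_ne hQ hQ' n
    have h4 : (-q) ^ (n ^ 2) = hSeq q n := by
      rw [hSeq, neg_pow]
      congr 1
      rw [sq_tri, pow_add, pow_mul]
      norm_num
    rw [show -q ^ 2 * (q ^ 2) ^ n = -(q ^ 2) ^ (n + 1) by ring, h4]
    field_simp
  rw [h1, ← hgs.tsum_comm]
  refine tsum_congr fun m => ?_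
  rw [tailS, ← tsum_mul_left]

lemma eSeq_summable {q : ℂ} (hq : ‖q‖ < 1) : Summable fun m => ‖eSeq q m * (-q) ^ m‖ := by
  obtain ⟨C, hC, hu⟩ := euler_one_bdd hq
  have hD : Filter.Tendsto (fun s : ℕ => 2 / (1 + q ^ s)) Filter.atTop (nhds (2 / (1 + 0))) :=
    tendsto_const_nhds.div
      (tendsto_const_nhds.add (tendsto_pow_atTop_nhds_zero_of_norm_lt_one hq)) (by norm_num)
  obtain ⟨D, hDp, hD'⟩ := bdd_of_tendsto hD
  have hb : ∀ k, ‖eSeq q k‖ ≤ D * C := by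
    intro k
    rw [eSeq, mul_div_assoc, norm_mul, norm_mul, norm_pow, norm_neg, norm_one, one_pow, one_mul]
    exact mul_le_mul (hD' k) (hu k) (norm_nonneg _) hDp.le
  exact (summable_pow_series hb (z := -q) (by simpa using hq)).norm

lemma prod_split {q : ℂ} (hq : ‖q‖ < 1) :
    qPochInf (-q) (q ^ 2) * qPochInf (-q ^ 2) (q ^ 2) = qPochInf (-q) q := by
  have hQ := norm_sq_lt hq
  have h := tprod_even_mul_odd (f := fun j : ℕ => (1 - (-q) * q ^ j))
    (by simpa only [pow_mul] using multipliable_aux (-q) hQ)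
    (by
      have := multipliable_aux (-q ^ 2) hQ
      refine this.congr fun j => ?_
      ring)
  rw [qPochInf, qPochInf, qPochInf, ← h]
  congr 1
  · refine tprod_congr fun j => ?_
    rw [pow_mul]
  · refine tprod_congr fun j => ?_
    ring

/-- Ramanujan's identity: for |q|<1, `2φ(-q) - f(q) = Θ(-q)²/(q;q)_∞`. -/
theorem stmt_16 (q : ℂ) (hq : ‖q‖ < 1) :
    2 * mockPhi (-q) - mockF q = thetaNeg q ^ 2 / qPochInf q q := by
  have hq' : ‖-q‖ < 1 := by simpa using hq
  have hQ := norm_sq_lt hq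
  obtain ⟨C, hC, hu⟩ := qPoch_inv_bdd hQ hQ
  have s0 := summable_pow_series hu hq'
  have sE := eSeq_summable hq
  have hcauchy := tsum_mul_tsum_eq_tsum_sum_antidiagonal_of_summable_norm sE s0.norm
  have sC := (summable_norm_sum_mul_antidiagonal_of_summable_norm sE s0.norm).of_norm
  have hterm : ∀ m, ∑ p ∈ Finset.HasAntidiagonal.antidiagonal m, eSeq q p.1 * (-q) ^ p.1 *
      ((qPoch (q ^ 2) (q ^ 2) p.2)⁻¹ * (-q) ^ p.2) = (-q) ^ m * ySum q m := by
    intro m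
    rw [ySum, Finset.mul_sum]
    refine Finset.sum_congr rfl fun p hp => ?_
    rw [← Finset.HasAntidiagonal.mem_antidiagonal.mp hp, pow_add]
    ring
  simp only [hterm] at hcauchy sC
  have h1 : 2 * (qPochInf (-q ^ 2) (q ^ 2) * mockPhi (-q)) =
      thetaNeg q * ∑' m, (qPoch (q ^ 2) (q ^ 2) m)⁻¹ * (-q) ^ m
      + ∑' m, (-q) ^ m * ySum q m := by
    rw [mockPhi_eq hq, ← tsum_mul_left, ← tsum_mul_left, ← (s0.mul_left _).tsum_add sC]
    refine tsum_congr fun m => ?_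
    have := y_eq hq m
    have hn := qq_ne hQ m
    field_simp
    linear_combination -(-q) ^ m * this
  rw [← hcauchy, ← mockF_eq hq] at h1
  have h2 := euler_two hQ hq'
  have h3 := prod_split hq
  have hL := qPochInf_ne hq hq'
  have hP := qPochInf_ne hq hq
  have h4 : qPochInf (-q) q * (2 * mockPhi (-q) - mockF q) = thetaNeg q := by
    set E := ∑' m, (qPoch (q ^ 2) (q ^ 2) m)⁻¹ * (-q) ^ m
    linear_combination qPochInf (-q) (q ^ 2) * h1 - 2 * mockPhi (-q) * h3
      + (thetaNeg q + qPochInf (-q) q * mockF q) * h2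
  have h5 : 2 * mockPhi (-q) - mockF q = thetaNeg q / qPochInf (-q) q := by
    rw [eq_div_iff hL, ← h4]; ring
  rw [h5, theta_prod hq]
  field_simp
end
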